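/- (Expansion of powers of I in star powers; Lemma on Op[Iⁿ].) Let d = 1 and I := p·q ∈ R. Define integers Γ_{n,k} for n ∈ ℕ, k ∈ ℤ by Γ_{n,k} = 0 if k < 0 or 2k > n, Γ_{n,0} = 1 for all n, and the recursion Γ_{n+1,k} = Γ_{n,k} + n²·Γ_{n−1,k−1} for k ≥ 1. Then for every n ∈ ℕ, the ordinary n-th power of I satisfies Iⁿ = Σ_{k=0}^{⌊n/2⌋} (−1)^k · Γ_{n,k} · (ħ/2)^{2k} · I^{⋆(n−2k)}, where I^{⋆m} denotes the m-fold star power I ⋆ I ⋆ ⋯ ⋆ I (with I^{⋆0} := 1). -/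

import Mathlib

open MvPolynomial

/-- Variables of the polynomial ring `R = ℂ[ħ, q₁, …, q_d, p₁, …, p_d]`:
`PVar.h` is `ħ`, `PVar.q k` is `q_k` and `PVar.p k` is `p_k`. -/
inductive PVar (d : ℕ) : Type where
  | h : PVar d
  | q : Fin d → PVar d
  | p : Fin d → PVar d
  deriving DecidableEq

/-- The commutative polynomial ring `R = ℂ[ħ, q₁, …, q_d, p₁, …, p_d]`. -/
abbrev Rpoly (d : ℕ) : Type := MvPolynomial (PVar d) ℂ

/-- `ħ` as an element of `R`. -/
noncomputable def hbar (d : ℕ) : Rpoly d := X PVar.h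

/-- The formal partial derivative with respect to a variable, as a linear endomorphism. -/
noncomputable def pd {d : ℕ} (v : PVar d) : Module.End ℂ (Rpoly d) :=
  (pderiv v).toLinearMap

/-- Iterated partial derivative `∂^μ` with respect to the family of variables `f`. -/
noncomputable def pdMulti {d : ℕ} (f : Fin d → PVar d) (μ : Fin d → ℕ) :
    Module.End ℂ (Rpoly d) :=
  (List.ofFn fun k => pd (f k) ^ μ k).prod

/-- The bidifferential operator
`P^n(A,B) = Σ_{μ,ν ∈ ℕ^d, |μ|+|ν|=n} (n!/(μ!·ν!)) (−1)^{|ν|} (∂_q^μ ∂_p^ν A)·(∂_p^μ ∂_q^ν B)`.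
(Any multi-index contributing to the sum has all entries `≤ n`, so the sum below over
`μ ν : Fin d → Fin (n+1)` captures exactly the nonzero part of this sum.) -/
noncomputable def Pop {d : ℕ} (n : ℕ) (A B : Rpoly d) : Rpoly d :=
  ∑ μ : Fin d → Fin (n + 1), ∑ ν : Fin d → Fin (n + 1),
    if (∑ k, (μ k : ℕ)) + (∑ k, (ν k : ℕ)) = n then
      C (((n.factorial : ℂ) /
            (((∏ k, Nat.factorial (μ k)) * ∏ k, Nat.factorial (ν k) : ℕ) : ℂ)) *
          (-1 : ℂ) ^ (∑ k, (ν k : ℕ))) *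
        pdMulti PVar.q (fun k => (μ k : ℕ)) (pdMulti PVar.p (fun k => (ν k : ℕ)) A) *
        pdMulti PVar.p (fun k => (μ k : ℕ)) (pdMulti PVar.q (fun k => (ν k : ℕ)) B)
    else 0

/-- The Poisson bracket `{A,B} = P^1(A,B) = Σ_k (∂_{q_k}A·∂_{p_k}B − ∂_{p_k}A·∂_{q_k}B)`. -/
noncomputable def poisson {d : ℕ} (A B : Rpoly d) : Rpoly d :=
  ∑ k : Fin d, (pd (PVar.q k) A * pd (PVar.p k) B - pd (PVar.p k) A * pd (PVar.q k) B)

/-- The Moyal bracket `{A,B}_M = Σ_{k≥0} ((−1)^k (ħ/2)^{2k}/(2k+1)!) P^{2k+1}(A,B)`.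
On polynomials this series is a finite sum: all terms with `2k+1` exceeding the total
degree vanish, so the truncation below equals the full series. -/
noncomputable def moyal {d : ℕ} (A B : Rpoly d) : Rpoly d :=
  ∑ k ∈ Finset.range (A.totalDegree + B.totalDegree + 1),
    C ((-1 : ℂ) ^ k / ((2 * k + 1).factorial : ℂ)) *
      (C (1 / 2 : ℂ) * hbar d) ^ (2 * k) * Pop (2 * k + 1) A B

/-- The Moyal star product `A⋆B = Σ_{k≥0} (1/k!)(iħ/2)^k P^k(A,B)`.
On polynomials this series is a finite sum: all terms with `k` exceeding the total
degree vanish, so the truncation below equals the full series. -/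
noncomputable def starP {d : ℕ} (A B : Rpoly d) : Rpoly d :=
  ∑ k ∈ Finset.range (A.totalDegree + B.totalDegree + 1),
    C ((k.factorial : ℂ))⁻¹ * (C (Complex.I / 2) * hbar d) ^ k * Pop k A B

/-- The Moyal adjoint `Mad_W A = {W,A}_M`. -/
noncomputable def Mad {d : ℕ} (W A : Rpoly d) : Rpoly d := moyal W A

/-- The weight of a variable: `q_k, p_k` have weight 1, `ħ` has weight 2. -/
def wtv {d : ℕ} : PVar d → ℕ
  | .h => 2
  | .q _ => 1
  | .p _ => 1

/-- The weight `2j + |α| + |β|` of a monomial `ħ^j q^α p^β` with exponent data `m`. -/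
def wt {d : ℕ} (m : PVar d →₀ ℕ) : ℕ := m.sum fun v e => wtv v * e

/-- The space `𝒲^s`: the ℂ-linear span of the monomials `ħ^j q^α p^β` with
`2j+|α|+|β| = s`; it is `{0}` for `s < 0`. -/
noncomputable def Wgr (d : ℕ) (s : ℤ) : Submodule ℂ (Rpoly d) :=
  Submodule.span ℂ {P : Rpoly d | ∃ m : PVar d →₀ ℕ, (wt m : ℤ) = s ∧ P = monomial m 1}

/-- The `m`-fold star power `A^{⋆m} = A ⋆ A ⋆ ⋯ ⋆ A`, with `A^{⋆0} = 1`. -/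
noncomputable def starPow (A : Rpoly 1) : ℕ → Rpoly 1
  | 0 => 1
  | m + 1 => starP A (starPow A m)

/-- The classical integral `I = p·q` for one degree of freedom. -/
noncomputable def Isad : Rpoly 1 := X (PVar.p 0) * X (PVar.q 0)

/-- The operator `B ↦ I·B + (iħ/2)(p ∂_p B − q ∂_q B) + (ħ/2)² ∂_p ∂_q B` of left star
multiplication by `I`. -/
noncomputable def leftStarIsad : Module.End ℂ (Rpoly 1) :=
  LinearMap.mulLeft ℂ Isad +
    LinearMap.mulLeft ℂ (C (Complex.I / 2) * hbar 1) ∘ₗ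
      (LinearMap.mulLeft ℂ (X (PVar.p 0)) ∘ₗ pd (PVar.p 0) -
        LinearMap.mulLeft ℂ (X (PVar.q 0)) ∘ₗ pd (PVar.q 0)) +
    LinearMap.mulLeft ℂ ((C (1 / 2) * hbar 1) ^ 2) ∘ₗ pd (PVar.p 0) ∘ₗ pd (PVar.q 0)

theorem leftStarIsad_apply (B : Rpoly 1) :
    leftStarIsad B = Isad * B + C (Complex.I / 2) * hbar 1 *
      (X (PVar.p 0) * pderiv (PVar.p 0) B - X (PVar.q 0) * pderiv (PVar.q 0) B) +
      (C (1 / 2) * hbar 1) ^ 2 * pderiv (PVar.p 0) (pderiv (PVar.q 0) B) := rfl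

theorem Pop_one_dim (n : ℕ) (A B : Rpoly 1) :
    Pop n A B = ∑ μ : Fin (n + 1), ∑ ν : Fin (n + 1),
      if (μ : ℕ) + (ν : ℕ) = n then
        C (((n.factorial : ℂ) / (((μ : ℕ).factorial * (ν : ℕ).factorial : ℕ) : ℂ)) *
          (-1 : ℂ) ^ (ν : ℕ)) *
        (pd (PVar.q 0) ^ (μ : ℕ)) ((pd (PVar.p 0) ^ (ν : ℕ)) A) *
        (pd (PVar.p 0) ^ (μ : ℕ)) ((pd (PVar.q 0) ^ (ν : ℕ)) B)
      else 0 := by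
  unfold Pop
  refine Fintype.sum_equiv (Equiv.funUnique (Fin 1) _) _ _ fun μ => ?_
  refine Fintype.sum_equiv (Equiv.funUnique (Fin 1) _) _ _ fun ν => ?_
  simp [pdMulti]

theorem pd_p_Isad : pd (PVar.p 0) Isad = X (PVar.q 0) := by
  simp [pd, Isad, Derivation.leibniz, pderiv_X]

theorem pd_q_Isad : pd (PVar.q 0) Isad = X (PVar.p 0) := by
  simp [pd, Isad, Derivation.leibniz, pderiv_X]

theorem pd_X {d : ℕ} (v w : PVar d) : pd v (X w) = if w = v then 1 else 0 := by
  simp [pd, pderiv_X, Pi.single_apply]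

theorem pd_one {d : ℕ} (v : PVar d) : pd v 1 = 0 := by
  simp [pd]

theorem pd_p_pow_Isad {ν : ℕ} (hν : 2 ≤ ν) : (pd (PVar.p 0) ^ ν) Isad = 0 := by
  obtain ⟨m, rfl⟩ := Nat.exists_eq_add_of_le' hν
  simp [pow_add, pow_two, Module.End.mul_apply, pd_p_Isad, pd_X]

theorem pd_q_pow_pd_p_pow_Isad {μ ν : ℕ} (h : 3 ≤ μ + ν) :
    (pd (PVar.q 0) ^ μ) ((pd (PVar.p 0) ^ ν) Isad) = 0 := by
  rcases le_or_gt 2 ν with hν | hν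
  · rw [pd_p_pow_Isad hν, map_zero]
  · obtain ⟨m, rfl⟩ := Nat.exists_eq_add_of_le' (show 2 ≤ μ by omega)
    interval_cases ν <;>
      simp [pow_add, pow_two, Module.End.mul_apply, pd_p_Isad, pd_q_Isad, pd_X, pd_one]

theorem Pop_Isad_eq_zero {n : ℕ} (hn : 3 ≤ n) (B : Rpoly 1) : Pop n Isad B = 0 := by
  rw [Pop_one_dim]
  refine Finset.sum_eq_zero fun μ _ => Finset.sum_eq_zero fun ν _ => ?_
  split_ifs with h
  · rw [pd_q_pow_pd_p_pow_Isad (by omega), mul_zero, zero_mul]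
  · rfl

theorem Pop_zero_Isad (B : Rpoly 1) : Pop 0 Isad B = Isad * B := by
  simp [Pop_one_dim]

theorem Pop_one_Isad (B : Rpoly 1) :
    Pop 1 Isad B = X (PVar.p 0) * pd (PVar.p 0) B - X (PVar.q 0) * pd (PVar.q 0) B := by
  simp [Pop_one_dim, Fin.sum_univ_succ, pd_p_Isad, pd_q_Isad]
  ring

theorem Pop_two_Isad (B : Rpoly 1) :
    Pop 2 Isad B = -2 * pd (PVar.p 0) (pd (PVar.q 0) B) := by
  simp [Pop_one_dim, Fin.sum_univ_succ, pd_p_Isad, pd_q_Isad, pow_two, Module.End.mul_apply,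
    pd_X]
  exact Or.inl (map_ofNat C 2)

theorem totalDegree_Isad : Isad.totalDegree = 2 := by
  rw [Isad, totalDegree_mul_of_isDomain (X_ne_zero _) (X_ne_zero _), totalDegree_X, totalDegree_X]

theorem starP_Isad (B : Rpoly 1) : starP Isad B = leftStarIsad B := by
  have hI : (C (Complex.I / 2) : Rpoly 1) ^ 2 = -C (1 / 2) ^ 2 := by
    rw [← C_pow, ← C_pow, ← C_neg, div_pow, Complex.I_sq]
    norm_num
  have h2 : (C (2 : ℂ)⁻¹ : Rpoly 1) * 2 = 1 := by
    rw [← map_ofNat C 2, ← C_mul]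
    norm_num
  rw [starP, totalDegree_Isad, show 2 + B.totalDegree + 1 = 3 + B.totalDegree by omega,
    Finset.sum_range_add, Finset.sum_eq_zero (s := Finset.range B.totalDegree), add_zero,
    Finset.sum_range_succ, Finset.sum_range_succ, Finset.sum_range_one, Pop_zero_Isad,
    Pop_one_Isad, Pop_two_Isad, leftStarIsad_apply]
  · simp only [Nat.factorial, pd, mul_pow, hI]
    simp
    linear_combination (C (2 : ℂ)⁻¹ ^ 2 * hbar 1 ^ 2 *
      pderiv (PVar.p 0) (pderiv (PVar.q 0) B)) * h2
  · intro k _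
    rw [Pop_Isad_eq_zero (by omega), mul_zero]

theorem starPow_Isad_succ (m : ℕ) :
    starPow Isad (m + 1) = leftStarIsad (starPow Isad m) := starP_Isad _

theorem leftStarIsad_C_mul_hbar_pow_mul (a : ℂ) (j : ℕ) (B : Rpoly 1) :
    leftStarIsad (C a * (C (1 / 2) * hbar 1) ^ j * B) =
      C a * (C (1 / 2) * hbar 1) ^ j * leftStarIsad B := by
  have hd (v : PVar 1) (hv : v ≠ PVar.h) (A : Rpoly 1) :
      pderiv v (C a * (C (1 / 2) * hbar 1) ^ j * A) =
        C a * (C (1 / 2) * hbar 1) ^ j * pderiv v A := by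
    simp [hbar, Derivation.leibniz, Derivation.leibniz_pow, pderiv_X_of_ne hv.symm]
  simp only [leftStarIsad_apply, hd _ (by simp : PVar.p 0 ≠ PVar.h),
    hd _ (by simp : PVar.q 0 ≠ PVar.h)]
  ring

theorem pderiv_p_pderiv_q_Isad_pow (n : ℕ) :
    pderiv (PVar.p 0) (pderiv (PVar.q 0) (Isad ^ n)) = (n : Rpoly 1) ^ 2 * Isad ^ (n - 1) := by
  have hp : pderiv (PVar.p 0) Isad = X (PVar.q 0) := pd_p_Isad
  have hq : pderiv (PVar.q 0) Isad = X (PVar.p 0) := pd_q_Isad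
  rcases n with _ | _ | n
  · simp
  · simp [hq]
  · simp only [Derivation.leibniz_pow, Derivation.leibniz, hp, hq, smul_eq_mul, nsmul_eq_mul,
      pderiv_X_self, Derivation.map_natCast, Nat.add_sub_cancel]
    have hI : Isad = X (PVar.p 0) * X (PVar.q 0) := rfl
    push_cast
    rw [hI]
    ring

/-- `I ⋆ Iⁿ = Iⁿ⁺¹ + (ħ/2)² n² Iⁿ⁻¹`. -/
theorem leftStarIsad_Isad_pow (n : ℕ) :
    leftStarIsad (Isad ^ n) =
      Isad ^ (n + 1) + (C (1 / 2) * hbar 1) ^ 2 * ((n : Rpoly 1) ^ 2 * Isad ^ (n - 1)) := by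
  have hp : pderiv (PVar.p 0) Isad = X (PVar.q 0) := pd_p_Isad
  have hq : pderiv (PVar.q 0) Isad = X (PVar.p 0) := pd_q_Isad
  rw [leftStarIsad_apply, pderiv_p_pderiv_q_Isad_pow, Derivation.leibniz_pow,
    Derivation.leibniz_pow, hp, hq]
  simp only [smul_eq_mul, nsmul_eq_mul]
  ring

/-- The `k`-th term of the expansion of `Iⁿ` in star powers, with coefficients `Γ`. -/
noncomputable def starExpansionTerm (Γ : ℕ → ℤ → ℤ) (n k : ℕ) : Rpoly 1 :=
  C ((-1 : ℂ) ^ k * (Γ n (k : ℤ) : ℂ)) * (C (1 / 2 : ℂ) * hbar 1) ^ (2 * k) *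
    starPow Isad (n - 2 * k)

theorem starExpansionTerm_eq_zero {Γ : ℕ → ℤ → ℤ}
    (hΓ0 : ∀ (n : ℕ) (k : ℤ), k < 0 ∨ (n : ℤ) < 2 * k → Γ n k = 0)
    {n k : ℕ} (h : n < 2 * k) : starExpansionTerm Γ n k = 0 := by
  simp [starExpansionTerm, hΓ0 n k (Or.inr (by omega))]

theorem leftStarIsad_starExpansionTerm {Γ : ℕ → ℤ → ℤ}
    (hΓ0 : ∀ (n : ℕ) (k : ℤ), k < 0 ∨ (n : ℤ) < 2 * k → Γ n k = 0) (n k : ℕ) :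
    leftStarIsad (starExpansionTerm Γ n k) =
      C ((-1 : ℂ) ^ k * (Γ n (k : ℤ) : ℂ)) * (C (1 / 2 : ℂ) * hbar 1) ^ (2 * k) *
        starPow Isad (n + 1 - 2 * k) := by
  rcases lt_or_ge n (2 * k) with h | h
  · rw [starExpansionTerm_eq_zero hΓ0 h, hΓ0 n k (Or.inr (by omega))]
    simp
  · rw [starExpansionTerm, leftStarIsad_C_mul_hbar_pow_mul, ← starPow_Isad_succ,
      Nat.sub_add_comm h]

theorem starExpansionTerm_succ_succ {Γ : ℕ → ℤ → ℤ}
    (hΓ0 : ∀ (n : ℕ) (k : ℤ), k < 0 ∨ (n : ℤ) < 2 * k → Γ n k = 0)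
    (hΓrec : ∀ (n : ℕ) (k : ℤ), 1 ≤ k →
      Γ (n + 1) k = Γ n k + (n : ℤ) ^ 2 * Γ (n - 1) (k - 1))
    (n k : ℕ) :
    starExpansionTerm Γ (n + 1) (k + 1) = leftStarIsad (starExpansionTerm Γ n (k + 1)) -
      (C (1 / 2) * hbar 1) ^ 2 * ((n : Rpoly 1) ^ 2 * starExpansionTerm Γ (n - 1) k) := by
  have hrec := hΓrec n (k + 1) (by omega)
  rw [add_sub_cancel_right] at hrec
  rw [leftStarIsad_starExpansionTerm hΓ0, starExpansionTerm, starExpansionTerm, Nat.cast_succ,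
    hrec, show n - 1 - 2 * k = n + 1 - 2 * (k + 1) by omega]
  push_cast
  simp only [C_mul, C_add, C_pow, C_neg, C_1, map_natCast]
  ring

theorem Isad_pow_eq_sum_starExpansionTerm {Γ : ℕ → ℤ → ℤ}
    (hΓ0 : ∀ (n : ℕ) (k : ℤ), k < 0 ∨ (n : ℤ) < 2 * k → Γ n k = 0)
    (hΓ1 : ∀ n : ℕ, Γ n 0 = 1)
    (hΓrec : ∀ (n : ℕ) (k : ℤ), 1 ≤ k →
      Γ (n + 1) k = Γ n k + (n : ℤ) ^ 2 * Γ (n - 1) (k - 1))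
    (n : ℕ) :
    Isad ^ n = ∑ k ∈ Finset.range (n / 2 + 1), starExpansionTerm Γ n k := by
  have extend {m N : ℕ} (h : m / 2 + 1 ≤ N) :
      ∑ k ∈ Finset.range (m / 2 + 1), starExpansionTerm Γ m k =
        ∑ k ∈ Finset.range N, starExpansionTerm Γ m k := by
    refine Finset.sum_subset (Finset.range_mono h) fun k _ hk => ?_
    rw [Finset.mem_range] at hk
    exact starExpansionTerm_eq_zero hΓ0 (by omega)
  induction n using Nat.strong_induction_on with
  | _ n ih =>
    rcases n with _ | n
    · simp [starExpansionTerm, hΓ1, starPow]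
    · have hzero : starExpansionTerm Γ (n + 1) 0 = leftStarIsad (starExpansionTerm Γ n 0) := by
        simp [starExpansionTerm, hΓ1, starPow_Isad_succ]
      rw [eq_sub_of_add_eq (leftStarIsad_Isad_pow n).symm, ih n (by omega),
        ih (n - 1) (by omega), extend (N := n + 1 + 1) (by omega),
        extend (N := n + 1) (by omega), extend (N := n + 1 + 1) (by omega),
        Finset.sum_range_succ' (starExpansionTerm Γ (n + 1)), hzero,
        Finset.sum_range_succ' (starExpansionTerm Γ n), map_add, map_sum,
        Finset.sum_congr rfl fun k _ => starExpansionTerm_succ_succ hΓ0 hΓrec n k,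
        Finset.sum_sub_distrib, ← Finset.mul_sum, ← Finset.mul_sum]
      ring

/-- Expansion of powers of `I` in star powers. Let `Γ_{n,k}` be the
integers with `Γ_{n,k} = 0` for `k < 0` or `2k > n`, `Γ_{n,0} = 1`, and
`Γ_{n+1,k} = Γ_{n,k} + n²·Γ_{n−1,k−1}` for `k ≥ 1`. Then
`Iⁿ = Σ_{k=0}^{⌊n/2⌋} (−1)^k Γ_{n,k} (ħ/2)^{2k} I^{⋆(n−2k)}`. -/
theorem I_pow_eq_sum_star_powers (Γ : ℕ → ℤ → ℤ)
    (hΓ0 : ∀ (n : ℕ) (k : ℤ), k < 0 ∨ (n : ℤ) < 2 * k → Γ n k = 0)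
    (hΓ1 : ∀ n : ℕ, Γ n 0 = 1)
    (hΓrec : ∀ (n : ℕ) (k : ℤ), 1 ≤ k →
      Γ (n + 1) k = Γ n k + (n : ℤ) ^ 2 * Γ (n - 1) (k - 1))
    (n : ℕ) :
    Isad ^ n = ∑ k ∈ Finset.range (n / 2 + 1),
      C ((-1 : ℂ) ^ k * (Γ n (k : ℤ) : ℂ)) * (C (1 / 2 : ℂ) * hbar 1) ^ (2 * k) *
        starPow Isad (n - 2 * k) := by
  exact Isad_pow_eq_sum_starExpansionTerm hΓ0 hΓ1 hΓrec n
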